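/- Let q be an odd prime power, V an m-dimensional F_q-vector space, X the group of symmetric bilinear forms on V, and Y ≤ X an additive subgroup such that every nonzero element of Y has rank ≥ 2δ−1 (a (2δ−1)-code). Then |Y| ≤ q^{m((m+1)/2−δ+1)} if m is odd, and |Y| ≤ q^{(m+1)(m/2−δ+1)} if m is even. -/

import Mathlib

open Matrix

/-- The Gaussian binomial coefficient with base `b`. -/
def gaussBinom (b : ℕ) : ℕ → ℕ → ℕ
  | _, 0 => 1
  | 0, _ + 1 => 0
  | n + 1, k + 1 => gaussBinom b n k + b ^ (k + 1) * gaussBinom b n (k + 1)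

namespace gaussBinom

variable (b : ℕ)

@[simp] lemma zero_right (n : ℕ) : gaussBinom b n 0 = 1 := by cases n <;> rfl

lemma succ_succ (n k : ℕ) : gaussBinom b (n + 1) (k + 1) =
    gaussBinom b n k + b ^ (k + 1) * gaussBinom b n (k + 1) := rfl

lemma eq_zero_of_lt {n k : ℕ} (h : n < k) : gaussBinom b n k = 0 := by
  induction n generalizing k with
  | zero => obtain ⟨k, rfl⟩ := Nat.exists_eq_add_one_of_ne_zero h.ne_zero; rfl
  | succ n ih =>
    obtain ⟨k, rfl⟩ := Nat.exists_eq_add_one_of_ne_zero h.ne_zero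
    rw [succ_succ, ih (by lia), ih (by lia), mul_zero, add_zero]

lemma zero_left (k : ℕ) : gaussBinom b 0 k = if k = 0 then 1 else 0 := by
  cases k <;> rfl

lemma self (n : ℕ) : gaussBinom b n n = 1 := by
  induction n with
  | zero => rfl
  | succ n ih => rw [succ_succ, ih, eq_zero_of_lt b n.lt_succ_self, mul_zero, add_zero]

lemma succ_succ' {n k d : ℕ} (h : n = k + d) : gaussBinom b (n + 1) (k + 1) =
    gaussBinom b n (k + 1) + b ^ d * gaussBinom b n k := by
  induction n generalizing k d with
  | zero =>
    obtain ⟨rfl, rfl⟩ : k = 0 ∧ d = 0 := by lia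
    rfl
  | succ n ih =>
    rcases d with _ | d
    · obtain rfl : k = n + 1 := by lia
      simp [self, eq_zero_of_lt]
    · rcases k with _ | k
      · have h1 := ih (k := 0) (d := d) (by lia)
        calc gaussBinom b (n + 1 + 1) (0 + 1)
            = 1 + b ^ (0 + 1) * (gaussBinom b n (0 + 1) + b ^ d * 1) := by
              rw [succ_succ, h1, zero_right, zero_right]
          _ = 1 + b ^ (0 + 1) * gaussBinom b n (0 + 1) + b ^ (d + 1) * 1 := by ring
          _ = _ := by rw [succ_succ b n 0, zero_right, zero_right]
      · have h1 := ih (k := k) (d := d + 1) (by lia)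
        have h2 := ih (k := k + 1) (d := d) (by lia)
        calc gaussBinom b (n + 1 + 1) (k + 1 + 1)
            = gaussBinom b n (k + 1) + b ^ (d + 1) * gaussBinom b n k + b ^ (k + 1 + 1) *
              (gaussBinom b n (k + 1 + 1) + b ^ d * gaussBinom b n (k + 1)) := by
              rw [succ_succ, h1, h2]
          _ = gaussBinom b n (k + 1) + b ^ (k + 1 + 1) * gaussBinom b n (k + 1 + 1) +
              b ^ (d + 1) * (gaussBinom b n k + b ^ (k + 1) * gaussBinom b n (k + 1)) := by ring
          _ = _ := by rw [succ_succ b n (k + 1), succ_succ b n k]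

/-- The second Pascal rule, in a form that is also valid when `n < k`. -/
lemma pow_mul_succ_succ {n k a d : ℕ} (h : a + n = d + k) :
    b ^ a * gaussBinom b (n + 1) (k + 1) =
      b ^ a * gaussBinom b n (k + 1) + b ^ d * gaussBinom b n k := by
  rcases lt_or_ge n k with hk | hk
  · simp [eq_zero_of_lt b hk, eq_zero_of_lt b (show n + 1 < k + 1 by lia),
      eq_zero_of_lt b (show n < k + 1 by lia)]
  · obtain ⟨e, rfl⟩ := Nat.exists_eq_add_of_le hk
    rw [succ_succ' b rfl, show d = a + e by lia]
    ring

lemma symm (i j : ℕ) : gaussBinom b (i + j) i = gaussBinom b (i + j) j := by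
  induction h : i + j generalizing i j with
  | zero => obtain ⟨rfl, rfl⟩ : i = 0 ∧ j = 0 := by lia
            rfl
  | succ n ih =>
    rcases i with _ | i
    · obtain rfl : j = n + 1 := by lia
      simp [self]
    rcases j with _ | j
    · obtain rfl : i = n := by lia
      simp [self]
    rw [succ_succ, succ_succ' b (show n = j + (i + 1) by lia), ih i (j + 1) (by lia),
      ih (i + 1) j (by lia)]

lemma pos (i j : ℕ) : 0 < gaussBinom b (i + j) j := by
  induction j with
  | zero => simp
  | succ j ih => rw [← add_assoc, succ_succ]; positivity

end gaussBinom

section Rank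

variable {F : Type*} [Field F] {ι κ : Type*} [Fintype ι] [Fintype κ]

lemma Matrix.rank_fromRows_replicateRow (M : Matrix ι κ F) (r : κ → F)
    [Decidable (r ∈ Submodule.span F (Set.range M.row))] :
    (fromRows M (replicateRow Unit r)).rank =
      M.rank + if r ∈ Submodule.span F (Set.range M.row) then 0 else 1 := by
  have h : Set.range (fromRows M (replicateRow Unit r)).row = Set.range M.row ∪ {r} := by
    ext v
    simp only [Set.mem_range, Sum.exists, Set.mem_union, Set.mem_singleton_iff]
    refine or_congr Iff.rfl ⟨fun ⟨_, h⟩ => h.symm, fun h => ⟨(), h.symm⟩⟩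
  rw [rank_eq_finrank_span_row, rank_eq_finrank_span_row, h, Submodule.span_union]
  split_ifs with hr
  · rw [sup_eq_left.mpr ((Submodule.span_singleton_le_iff_mem _ _).mpr hr), add_zero]
  · exact Submodule.finrank_sup_span_singleton hr

/-- The symmetric matrix obtained from `x` by adding one row and column. -/
def bordered (x : Matrix ι ι F) (u : ι → F) (t : F) : Matrix (ι ⊕ Unit) (ι ⊕ Unit) F :=
  fromBlocks x (replicateCol Unit u) (replicateRow Unit u) (of fun _ _ => t)

omit [Fintype κ] in
lemma mem_span_row_iff (M : Matrix ι κ F) (r : κ → F) :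
    r ∈ Submodule.span F (Set.range M.row) ↔ ∃ z, z ᵥ* M = r := by
  rw [← range_vecMulLinear]; rfl

lemma rank_bordered_of_notMem {x : Matrix ι ι F} (hx : x.IsSymm) {u : ι → F}
    (hu : ∀ y, x *ᵥ y ≠ u) (t : F) : (bordered x u t).rank = x.rank + 2 := by
  classical
  have h1 : bordered x u t = fromRows (fromRows x (replicateRow Unit u))ᵀ
      (replicateRow Unit (Sum.elim u fun _ => t)) := by
    ext (i | i) (j | j) <;> simp [bordered, hx.apply]
  have h2 : u ∉ Submodule.span F (Set.range x.row) := by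
    rw [mem_span_row_iff]
    rintro ⟨z, hz⟩
    apply hu z
    rw [← hx, mulVec_transpose, hz]
  rw [h1, rank_fromRows_replicateRow, rank_transpose, rank_fromRows_replicateRow, if_neg h2,
    if_neg]
  rw [mem_span_row_iff]
  rintro ⟨z, hz⟩
  refine hu z ?_
  ext i
  have := congrFun hz (Sum.inl i)
  rwa [vecMul_transpose] at this

lemma rank_bordered_mulVec [DecidableEq F] {x : Matrix ι ι F} (hx : x.IsSymm) (y : ι → F) (t : F) :
    (bordered x (x *ᵥ y) t).rank = x.rank + if t = y ⬝ᵥ x *ᵥ y then 0 else 1 := by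
  classical
  have h1 : bordered x (x *ᵥ y) t = fromRows (fromRows x (replicateRow Unit (x *ᵥ y)))ᵀ
      (replicateRow Unit (Sum.elim (x *ᵥ y) fun _ => t)) := by
    ext (i | i) (j | j) <;> simp [bordered, hx.apply]
  have hy : y ᵥ* x = x *ᵥ y := by
    conv_rhs => rw [← hx, mulVec_transpose]
  have h2 : x *ᵥ y ∈ Submodule.span F (Set.range x.row) := by
    rw [mem_span_row_iff]
    exact ⟨y, hy⟩
  rw [h1, rank_fromRows_replicateRow, rank_transpose, rank_fromRows_replicateRow, if_pos h2,
    add_zero]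
  congr 2
  rw [mem_span_row_iff, eq_iff_iff]
  constructor
  · rintro ⟨z, hz⟩
    rw [vecMul_transpose] at hz
    have hz1 : x *ᵥ z = x *ᵥ y := by
      ext i; exact congrFun hz (Sum.inl i)
    have hz2 : (x *ᵥ y) ⬝ᵥ z = t := congrFun hz (Sum.inr ())
    rw [← hz2, ← hz1, dotProduct_mulVec, hy, ← hz1]
  · rintro rfl
    refine ⟨y, ?_⟩
    rw [vecMul_transpose]
    ext (i | i)
    · rfl
    · exact dotProduct_comm _ _

end Rank

section Diagonal

variable {F : Type*} [Field F]

lemma Matrix.IsSymm.exists_isUnit_diagonal (h2 : (2 : F) ≠ 0) {m : ℕ}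
    {C : Matrix (Fin m) (Fin m) F} (hC : C.IsSymm) :
    ∃ (P : Matrix (Fin m) (Fin m) F) (w : Fin m → F), IsUnit P ∧ Pᵀ * C * P = diagonal w := by
  have : Invertible (2 : F) := invertibleOfNonzero h2
  have hB : LinearMap.IsSymm (toBilin' C) :=
    ⟨(isSymm_toBilin'_iff_isSymm.mpr hC).eq⟩
  obtain ⟨v, hv⟩ := LinearMap.BilinForm.exists_orthogonal_basis hB
  have hv0 : ∀ i j, i ≠ j → toBilin' C (v i) (v j) = 0 := fun i j h => hv h
  let v' := v.reindex (finCongr (Module.finrank_fin_fun F))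
  refine ⟨(Pi.basisFun F (Fin m)).toMatrix v', fun i => toBilin' C (v' i) (v' i),
    ⟨⟨_, _, (Pi.basisFun F (Fin m)).toMatrix_mul_toMatrix_flip v',
      v'.toMatrix_mul_toMatrix_flip _⟩, rfl⟩, ?_⟩
  have := LinearMap.BilinForm.toMatrix_mul_basis_toMatrix (Pi.basisFun F (Fin m)) v' (toBilin' C)
  rw [show LinearMap.BilinForm.toMatrix (Pi.basisFun F (Fin m)) (toBilin' C) = C from
    LinearMap.BilinForm.toMatrix'_toBilin' C] at this
  rw [this]
  ext i j
  rw [LinearMap.BilinForm.toMatrix_apply, diagonal_apply]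
  split_ifs with h
  · rw [h]
  · rw [Module.Basis.reindex_apply, Module.Basis.reindex_apply]
    exact hv0 _ _ fun e => h ((finCongr (Module.finrank_fin_fun F)).symm.injective e)

end Diagonal

section Gauss

variable {F : Type*} [Field F] [Fintype F] [DecidableEq F]

lemma sum_addChar_mul_sq (hF : ringChar F ≠ 2) {ψ : AddChar F ℂ} (hψ : ψ.IsPrimitive) {c : F}
    (hc : c ≠ 0) : ∑ y, ψ (c * y ^ 2) =
      gaussSum ((quadraticChar F).ringHomComp (Int.castRingHom ℂ)) (ψ.mulShift c) := by
  have h1 : ∑ u, ψ (c * u) = 0 := by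
    simp_rw [mul_comm c]
    rw [AddChar.sum_mulShift c hψ, if_neg hc, Nat.cast_zero]
  rw [← Finset.sum_fiberwise Finset.univ (fun y => y ^ 2), ← add_zero (gaussSum _ _), ← h1,
    gaussSum, ← Finset.sum_add_distrib]
  refine Finset.sum_congr rfl fun u _ => ?_
  rw [Finset.sum_congr rfl (g := fun _ => ψ (c * u)) fun y hy => by
    rw [(Finset.mem_filter.mp hy).2], Finset.sum_const, nsmul_eq_mul]
  have h2 := quadraticChar_card_sqrts hF u
  rw [Set.toFinset_ofPred] at h2
  have h3 : ((Finset.univ.filter fun y : F => y ^ 2 = u).card : ℂ) =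
      ((quadraticChar F u : ℤ) : ℂ) + 1 := by exact_mod_cast congrArg (Int.cast (R := ℂ)) h2
  rw [h3]
  simp [AddChar.mulShift_apply, add_mul]

lemma quadraticChar_mul_sum_sq (hF : ringChar F ≠ 2) {ψ : AddChar F ℂ} (hψ : ψ.IsPrimitive)
    {a w : F} (ha : a ≠ 0) (hw : w ≠ 0) :
    ((quadraticChar F a : ℤ) : ℂ) * ∑ y, ψ (a * (w * y ^ 2)) = ∑ y, ψ (w * y ^ 2) := by
  simp_rw [← mul_assoc]
  rw [sum_addChar_mul_sq hF hψ (mul_ne_zero ha hw), sum_addChar_mul_sq hF hψ hw,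
    ← gaussSum_mulShift _ (ψ.mulShift w) (Units.mk0 a ha)]
  congr 2
  ext y
  simp [AddChar.mulShift_apply, mul_assoc, mul_left_comm]

lemma AddChar.map_finset_sum {A M σ : Type*} [AddCommMonoid A] [CommMonoid M] (ψ : AddChar A M)
    (s : Finset σ) (f : σ → A) : ψ (∑ i ∈ s, f i) = ∏ i ∈ s, ψ (f i) :=
  map_prod ψ.toMonoidHom (fun i => Multiplicative.ofAdd (f i)) s

lemma sum_addChar_mul_quadratic (hF : ringChar F ≠ 2) {ψ : AddChar F ℂ} (hψ : ψ.IsPrimitive) {m : ℕ}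
    {x : Matrix (Fin m) (Fin m) F} (hx : x.IsSymm) (hr : Even x.rank) {a : F} (ha : a ≠ 0) :
    ∑ y, ψ (a * (y ⬝ᵥ x *ᵥ y)) = ∑ y, ψ (y ⬝ᵥ x *ᵥ y) := by
  obtain ⟨P, w, hP, hw⟩ := hx.exists_isUnit_diagonal (Ring.two_ne_zero hF)
  have hdiag (c : F) : ∑ y, ψ (c * (y ⬝ᵥ x *ᵥ y)) = ∏ i, ∑ y, ψ (c * (w i * y ^ 2)) := by
    have hb : Function.Bijective (P *ᵥ ·) :=
      ⟨mulVec_injective_iff_isUnit.mpr hP, mulVec_surjective_iff_isUnit.mpr hP⟩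
    rw [← hb.sum_comp, Fintype.prod_sum]
    refine Finset.sum_congr rfl fun z _ => ?_
    rw [← AddChar.map_finset_sum, ← Finset.mul_sum]
    congr 2
    have : P *ᵥ z ⬝ᵥ x *ᵥ (P *ᵥ z) = z ⬝ᵥ (Pᵀ * x * P) *ᵥ z := by
      simp only [← mulVec_mulVec, dotProduct_mulVec, vecMul_transpose]
    rw [this, hw]
    simp only [dotProduct, mulVec_diagonal]
    exact Finset.sum_congr rfl fun i _ => by ring
  have hcard : Even (Finset.univ.filter fun i => w i ≠ 0).card := by
    rwa [← Fintype.card_subtype, ← rank_diagonal, ← hw,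
      rank_mul_eq_left_of_isUnit_det _ _ ((isUnit_iff_isUnit_det P).mp hP),
      rank_mul_eq_right_of_isUnit_det _ _ ((isUnit_iff_isUnit_det Pᵀ).mp
        ((isUnit_transpose P).mpr hP))]
  have h1 := hdiag 1
  simp only [one_mul] at h1
  rw [hdiag, h1]
  have hε : ((quadraticChar F a : ℤ) : ℂ) ^ (Finset.univ.filter fun i => w i ≠ 0).card = 1 := by
    obtain ⟨k, hk⟩ := even_iff_two_dvd.mp hcard
    rw [hk, pow_mul]
    have := quadraticChar_sq_one ha
    rw [← Int.cast_pow, this, Int.cast_one, one_pow]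
  calc _ = ((quadraticChar F a : ℤ) : ℂ) ^ (Finset.univ.filter fun i => w i ≠ 0).card *
        ∏ i, ∑ y, ψ (a * (w i * y ^ 2)) := by rw [hε, one_mul]
    _ = ∏ i, ((if w i ≠ 0 then ((quadraticChar F a : ℤ) : ℂ) else 1) *
        ∑ y, ψ (a * (w i * y ^ 2))) := by
      rw [Finset.prod_mul_distrib, Finset.prod_ite, Finset.prod_const, Finset.prod_const_one,
        mul_one]
    _ = _ := by
      refine Finset.prod_congr rfl fun i _ => ?_
      split_ifs with h
      · exact quadraticChar_mul_sum_sq hF hψ ha h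
      · simp [not_not.mp h]

end Gauss

section Sums

variable {F : Type*} [Field F] [Fintype F] [DecidableEq F]
variable {ι κ : Type*} [Fintype ι] [DecidableEq ι] [Fintype κ] [DecidableEq κ]

lemma card_pow_mul_sum_eq (x : Matrix ι ι F) (h : (ι → F) → ℂ)
    (hx : ∀ u, (∀ y, x *ᵥ y ≠ u) → h u = 0) :
    (Fintype.card F : ℂ) ^ Fintype.card ι * ∑ u, h u =
      (Fintype.card F : ℂ) ^ x.rank * ∑ y, h (x *ᵥ y) := by
  have hk : Fintype.card F ^ Fintype.card ι =
      Fintype.card F ^ x.rank * Nat.card (LinearMap.ker x.mulVecLin) := by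
    rw [Module.natCard_eq_pow_finrank (K := F) (V := LinearMap.ker x.mulVecLin),
      Nat.card_eq_fintype_card, ← pow_add]
    congr 1
    have := LinearMap.finrank_range_add_finrank_ker x.mulVecLin
    rw [Module.finrank_fintype_fun_eq_card] at this
    exact this.symm
  have hs : ∑ y, h (x *ᵥ y) = Nat.card (LinearMap.ker x.mulVecLin) * ∑ u, h u := by
    rw [← Finset.sum_fiberwise Finset.univ (fun y => x *ᵥ y), Finset.mul_sum]
    refine Finset.sum_congr rfl fun u _ => ?_
    rw [Finset.sum_congr rfl (g := fun _ => h u) fun y hy => by rw [(Finset.mem_filter.mp hy).2],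
      Finset.sum_const, nsmul_eq_mul]
    by_cases hu : ∃ y, x *ᵥ y = u
    · congr 2
      have := AddMonoidHom.card_fiber_eq_of_mem_range x.mulVecLin.toAddMonoidHom (x := u) (y := 0)
        hu ⟨0, by simp⟩
      refine (Eq.trans ?_ this).trans ?_
      · rfl
      · rw [← Fintype.card_subtype, ← Nat.card_eq_fintype_card]; rfl
    · rw [hx u fun y hy => hu ⟨y, hy⟩, mul_zero, mul_zero]
  rw [hs, ← mul_assoc]
  congr 1
  exact_mod_cast hk

/-- The Fourier transform, on symmetric matrices, of a function of the rank. -/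
noncomputable def symmSum (ψ : AddChar F ℂ) (g : ℕ → ℂ) (C : Matrix ι ι F) : ℂ :=
  ∑ x : {x : Matrix ι ι F // x.IsSymm}, g x.1.rank * ψ (trace (C * x.1))

lemma symmSum_submatrix (ψ : AddChar F ℂ) (g : ℕ → ℂ) (C : Matrix ι ι F) (e : κ ≃ ι) :
    symmSum ψ g (C.submatrix e e) = symmSum ψ g C := by
  refine Fintype.sum_equiv ((reindex e e).subtypeEquiv fun x =>
    ⟨fun h => h.submatrix _, fun h => ?_⟩) _ _ fun x => ?_
  · simpa using h.submatrix e
  · simp only [Equiv.subtypeEquiv_apply, reindex_apply, rank_submatrix]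
    congr 2
    simp only [trace, diag_apply, mul_apply, submatrix_apply]
    refine Fintype.sum_equiv e _ _ fun i => Fintype.sum_equiv e _ _ fun j => ?_
    simp

lemma symmSum_congruence (ψ : AddChar F ℂ) (g : ℕ → ℂ) (C : Matrix ι ι F) {P : Matrix ι ι F}
    (hP : IsUnit P) : symmSum ψ g (Pᵀ * C * P) = symmSum ψ g C := by
  obtain ⟨P, rfl⟩ := hP
  let e : Matrix ι ι F ≃ Matrix ι ι F :=
    { toFun := fun x => P.1 * x * (P.1)ᵀ
      invFun := fun x => P⁻¹.1 * x * (P⁻¹.1)ᵀ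
      left_inv := fun x => by
        have h : (P.1)ᵀ * (P⁻¹.1)ᵀ = 1 := by rw [← transpose_mul, Units.inv_mul, transpose_one]
        simp only [← mul_assoc, Units.inv_mul, one_mul]
        rw [mul_assoc, h, mul_one]
      right_inv := fun x => by
        have h : (P⁻¹.1)ᵀ * (P.1)ᵀ = 1 := by rw [← transpose_mul, Units.mul_inv, transpose_one]
        simp only [← mul_assoc, Units.mul_inv, one_mul]
        rw [mul_assoc, h, mul_one] }
  have he (x : Matrix ι ι F) : (e x).IsSymm ↔ (e x)ᵀ = e x := Iff.rfl
  refine Fintype.sum_equiv (e.subtypeEquiv fun x => ?_) _ _ fun x => ?_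
  · have : (e x)ᵀ = e xᵀ := by simp [e, mul_assoc]
    rw [he, this, e.injective.eq_iff, IsSymm]
  · have hu := (isUnit_iff_isUnit_det P.1).mp P.isUnit
    have hr : (e x.1).rank = x.1.rank := by
      simp only [e, Equiv.coe_fn_mk]
      rw [rank_mul_eq_left_of_isUnit_det _ _ (by rwa [det_transpose]),
        rank_mul_eq_right_of_isUnit_det _ _ hu]
    have ht : trace (C * e x.1) = trace ((P.1)ᵀ * C * P.1 * x.1) := by
      simp only [e, Equiv.coe_fn_mk]
      rw [← mul_assoc, ← mul_assoc, trace_mul_comm]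
      simp only [mul_assoc]
    rw [Equiv.subtypeEquiv_apply, hr, ht]

omit [Fintype F] [DecidableEq F] [DecidableEq ι] in
lemma trace_bordered_mul_bordered (C x : Matrix ι ι F) (v u : ι → F) (c t : F) :
    trace (bordered C v c * bordered x u t) = trace (C * x) + 2 * (v ⬝ᵥ u) + c * t := by
  rw [bordered, bordered, fromBlocks_multiply, trace, Fintype.sum_sum_type]
  simp only [diag_apply, fromBlocks_apply₁₁, fromBlocks_apply₂₂, Matrix.add_apply, mul_apply,
    replicateCol_apply, replicateRow_apply, of_apply, Finset.univ_unique, Finset.sum_singleton,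
    Finset.sum_add_distrib, dotProduct, trace]
  ring

omit [Field F] in
lemma sum_symm_sum_unit {M : Type*} [AddCommMonoid M]
    (f : Matrix (ι ⊕ Unit) (ι ⊕ Unit) F → M) :
    ∑ X : {X : Matrix (ι ⊕ Unit) (ι ⊕ Unit) F // X.IsSymm}, f X.1 =
      ∑ x : {x : Matrix ι ι F // x.IsSymm}, ∑ u : ι → F, ∑ t : F, f (bordered x.1 u t) := by
  simp only [← Fintype.sum_prod_type']
  let e : {x : Matrix ι ι F // x.IsSymm} × (ι → F) × F ≃
      {X : Matrix (ι ⊕ Unit) (ι ⊕ Unit) F // X.IsSymm} :=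
    { toFun := fun p => ⟨bordered p.1.1 p.2.1 p.2.2,
        IsSymm.fromBlocks p.1.2 (by ext; rfl) (by ext; rfl)⟩
      invFun := fun X => (⟨X.1.toBlocks₁₁, IsSymm.ext fun i j => X.2.apply _ _⟩,
        fun i => X.1 (Sum.inl i) (Sum.inr ()), X.1 (Sum.inr ()) (Sum.inr ()))
      left_inv := fun p => rfl
      right_inv := fun X => by
        refine Subtype.ext ?_
        ext (i | i) (j | j)
        · rfl
        · rfl
        · exact X.2.apply _ _
        · rfl }
  exact (Fintype.sum_equiv e _ _ fun p => rfl).symm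

/-- Summation over all one-row borders of a symmetric matrix. -/
lemma sum_rank_bordered {x : Matrix ι ι F} (hx : x.IsSymm) (g : ℕ → ℂ)
    (φ : (ι → F) → F → ℂ) :
    (Fintype.card F : ℂ) ^ Fintype.card ι * ∑ u, ∑ t, g (bordered x u t).rank * φ u t =
      (Fintype.card F : ℂ) ^ Fintype.card ι * (g (x.rank + 2) * ∑ u, ∑ t, φ u t) +
      (Fintype.card F : ℂ) ^ x.rank *
        ∑ y, ((g (x.rank + 1) - g (x.rank + 2)) * ∑ t, φ (x *ᵥ y) t +
          (g x.rank - g (x.rank + 1)) * φ (x *ᵥ y) (y ⬝ᵥ x *ᵥ y)) := by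
  have h := card_pow_mul_sum_eq x
    (fun u => ∑ t, (g (bordered x u t).rank - g (x.rank + 2)) * φ u t) fun u hu => by
      simp [rank_bordered_of_notMem hx hu]
  have h1 (y : ι → F) : ∑ t, (g (bordered x (x *ᵥ y) t).rank - g (x.rank + 2)) * φ (x *ᵥ y) t =
      (g (x.rank + 1) - g (x.rank + 2)) * ∑ t, φ (x *ᵥ y) t +
        (g x.rank - g (x.rank + 1)) * φ (x *ᵥ y) (y ⬝ᵥ x *ᵥ y) := by
    have h2 (t : F) : (g (bordered x (x *ᵥ y) t).rank - g (x.rank + 2)) * φ (x *ᵥ y) t =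
        (g (x.rank + 1) - g (x.rank + 2)) * φ (x *ᵥ y) t +
          if t = y ⬝ᵥ x *ᵥ y then (g x.rank - g (x.rank + 1)) * φ (x *ᵥ y) t else 0 := by
      rw [rank_bordered_mulVec hx]
      split_ifs
      · rw [add_zero]; ring
      · rw [add_zero]
    simp_rw [h2, Finset.sum_add_distrib, ← Finset.mul_sum]
    simp
  simp_rw [h1] at h
  rw [← h, ← mul_add]
  congr 1
  simp only [sub_mul, Finset.sum_sub_distrib, ← Finset.mul_sum]
  ring

end Sums

section Recursion

variable {F : Type*} [Field F] [Fintype F] [DecidableEq F]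
variable {ι κ : Type*} [Fintype ι] [DecidableEq ι] [Fintype κ] [DecidableEq κ]

lemma symmSum_bordered (ψ : AddChar F ℂ) (g : ℕ → ℂ) (C : Matrix ι ι F) (v : ι → F) (a : F) :
    symmSum ψ g (bordered C v a) = ∑ x : {x : Matrix ι ι F // x.IsSymm}, ψ (trace (C * x.1)) *
      ∑ u, ∑ t, g (bordered x.1 u t).rank * ψ (2 * (v ⬝ᵥ u) + a * t) := by
  rw [symmSum, sum_symm_sum_unit fun X => g X.rank * ψ (trace (bordered C v a * X))]
  refine Finset.sum_congr rfl fun x _ => ?_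
  simp only [Finset.mul_sum]
  refine Finset.sum_congr rfl fun u _ => Finset.sum_congr rfl fun t _ => ?_
  rw [trace_bordered_mul_bordered, add_assoc, AddChar.map_add_eq_mul]
  ring

/-- The effect on the weight `g` of integrating `symmSum` over the last row and column. -/
def pushWeight (q : ℂ) (m : ℕ) (g : ℕ → ℂ) (r : ℕ) : ℂ :=
  q ^ (m + 1) * g (r + 2) + q ^ r * (g r - g (r + 1)) + q ^ (r + 1) * (g (r + 1) - g (r + 2))

omit [DecidableEq F] in
lemma cast_card_ne_zero : (Fintype.card F : ℂ) ≠ 0 := by simp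

lemma symmSum_bordered_zero (ψ : AddChar F ℂ) (g : ℕ → ℂ) (C : Matrix ι ι F) :
    symmSum ψ g (bordered C 0 0) =
      symmSum ψ (pushWeight (Fintype.card F) (Fintype.card ι) g) C := by
  rw [symmSum_bordered, symmSum]
  refine Finset.sum_congr rfl fun x _ => ?_
  rw [mul_comm]
  congr 1
  refine mul_left_cancel₀ (pow_ne_zero (Fintype.card ι) (cast_card_ne_zero (F := F))) ?_
  rw [sum_rank_bordered x.2 g fun u t => ψ (2 * (0 ⬝ᵥ u) + 0 * t)]
  simp [pushWeight]
  ring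

lemma symmSum_bordered_ne_zero (hF : ringChar F ≠ 2) {ψ : AddChar F ℂ} (hψ : ψ.IsPrimitive)
    {g : ℕ → ℂ} (hg : ∀ r, Odd r → g r = g (r + 1)) {m : ℕ} (C : Matrix (Fin m) (Fin m) F)
    {a : F} (ha : a ≠ 0) : symmSum ψ g (bordered C 0 a) = symmSum ψ g (bordered C 0 1) := by
  rw [symmSum_bordered, symmSum_bordered]
  refine Finset.sum_congr rfl fun x _ => ?_
  congr 1
  refine mul_left_cancel₀ (pow_ne_zero m (cast_card_ne_zero (F := F))) ?_
  have h0 {b : F} (hb : b ≠ 0) : ∑ t, ψ (b * t) = 0 := by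
    simp_rw [mul_comm b]
    rw [AddChar.sum_mulShift b hψ, if_neg hb, Nat.cast_zero]
  have key {b : F} (hb : b ≠ 0) : (Fintype.card F : ℂ) ^ m * ∑ u, ∑ t, g (bordered x.1 u t).rank *
      ψ (2 * (0 ⬝ᵥ u) + b * t) = (Fintype.card F : ℂ) ^ x.1.rank *
        ((g x.1.rank - g (x.1.rank + 1)) * ∑ y, ψ (b * (y ⬝ᵥ x.1 *ᵥ y))) := by
    have := sum_rank_bordered x.2 g fun u t => ψ (2 * (0 ⬝ᵥ u) + b * t)
    rw [Fintype.card_fin] at this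
    rw [this]
    simp [h0 hb, Finset.mul_sum]
  rw [key ha, key one_ne_zero]
  rcases Nat.even_or_odd x.1.rank with hr | hr
  · rw [sum_addChar_mul_quadratic hF hψ x.2 hr ha]
    simp
  · rw [hg _ hr]
    simp

omit [Fintype F] [DecidableEq ι] in
lemma rank_bordered_zero (x : Matrix ι ι F) (hx : x.IsSymm) (t : F) :
    (bordered x 0 t).rank = x.rank + if t = 0 then 0 else 1 := by
  simpa using rank_bordered_mulVec hx 0 t

lemma sum_symmSum_bordered (hF : ringChar F ≠ 2) {ψ : AddChar F ℂ} (hψ : ψ.IsPrimitive)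
    (g : ℕ → ℂ) (C : Matrix ι ι F) : ∑ v, ∑ a, symmSum ψ g (bordered C v a) =
      (Fintype.card F : ℂ) ^ (Fintype.card ι + 1) * symmSum ψ g C := by
  have h2 := Ring.two_ne_zero hF
  have hs (b : F) : ∑ t, ψ (t * b) = if b = 0 then (Fintype.card F : ℂ) else 0 := by
    rw [AddChar.sum_mulShift b hψ]; split_ifs <;> simp
  have hv (u : ι → F) : ∑ v : ι → F, ψ (2 * (v ⬝ᵥ u)) =
      if u = 0 then (Fintype.card F : ℂ) ^ Fintype.card ι else 0 := by
    have : ∀ v : ι → F, ψ (2 * (v ⬝ᵥ u)) = ∏ i, ψ (v i * (2 * u i)) := fun v => by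
      rw [← AddChar.map_finset_sum, dotProduct, Finset.mul_sum]
      congr 1
      exact Finset.sum_congr rfl fun i _ => by ring
    simp_rw [this]
    rw [← Fintype.prod_sum fun i (t : F) => ψ (t * (2 * u i))]
    simp_rw [hs]
    split_ifs with hu
    · subst hu; simp
    · obtain ⟨i, hi⟩ := Function.ne_iff.mp hu
      exact Finset.prod_eq_zero (Finset.mem_univ i) (if_neg (mul_ne_zero h2 hi))
  simp_rw [symmSum_bordered]
  have hc : ∀ v : ι → F, ∑ a : F, ∑ x : {x : Matrix ι ι F // x.IsSymm}, ψ (trace (C * x.1)) *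
      ∑ u, ∑ t, g (bordered x.1 u t).rank * ψ (2 * (v ⬝ᵥ u) + a * t) =
      ∑ x : {x : Matrix ι ι F // x.IsSymm}, ψ (trace (C * x.1)) *
        ∑ u, g (bordered x.1 u 0).rank * ψ (2 * (v ⬝ᵥ u)) * Fintype.card F := fun v => by
    rw [Finset.sum_comm]
    refine Finset.sum_congr rfl fun x _ => ?_
    rw [← Finset.mul_sum, Finset.sum_comm]
    congr 1
    refine Finset.sum_congr rfl fun u _ => ?_
    rw [Finset.sum_comm]
    simp_rw [AddChar.map_add_eq_mul, ← mul_assoc, ← Finset.mul_sum, hs]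
    simp
  simp_rw [hc]
  rw [Finset.sum_comm, symmSum, Finset.mul_sum]
  refine Finset.sum_congr rfl fun x _ => ?_
  rw [← Finset.mul_sum, Finset.sum_comm]
  simp_rw [← Finset.sum_mul, ← Finset.mul_sum, hv]
  simp [rank_bordered_zero x.1 x.2]
  ring

omit [Fintype F] [DecidableEq F] in
lemma exists_congruence_bordered {C : Matrix ι ι F} (hC : C.IsSymm) (hu : IsUnit C) (v : ι → F) :
    ∃ P : Matrix (ι ⊕ Unit) (ι ⊕ Unit) F, IsUnit P ∧
      ∀ a, Pᵀ * bordered C v a * P = bordered C 0 (a - v ⬝ᵥ C⁻¹ *ᵥ v) := by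
  have hd := (isUnit_iff_isUnit_det C).mp hu
  refine ⟨fromBlocks 1 (replicateCol Unit (-(C⁻¹ *ᵥ v))) 0 1, ?_, fun a => ?_⟩
  · rw [isUnit_iff_isUnit_det, det_fromBlocks_zero₂₁]
    simp
  · have h1 : C *ᵥ (C⁻¹ *ᵥ v) = v := by rw [mulVec_mulVec, mul_nonsing_inv C hd, one_mulVec]
    have h2 : (C⁻¹ *ᵥ v) ᵥ* C = v := by
      rw [← mulVec_transpose, hC, h1]
    rw [bordered, bordered, fromBlocks_transpose, fromBlocks_multiply, fromBlocks_multiply]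
    simp only [transpose_one, transpose_zero, Matrix.one_mul, Matrix.mul_one, Matrix.zero_mul,
      Matrix.mul_zero, add_zero, transpose_replicateCol]
    have e1 : C * replicateCol Unit (-(C⁻¹ *ᵥ v)) = - replicateCol Unit v := by
      rw [← replicateCol_mulVec, mulVec_neg, h1]; ext; rfl
    have e2 : replicateRow Unit (-(C⁻¹ *ᵥ v)) * C = - replicateRow Unit v := by
      rw [← replicateRow_vecMul, neg_vecMul, h2]; ext; rfl
    rw [e1, e2, neg_add_cancel, neg_add_cancel, Matrix.zero_mul, zero_add]
    congr 1
    ext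
    simp [dotProduct_comm, neg_add_eq_sub]

/-- The value of `symmSum` at a one-dimensional extension of an invertible matrix. -/
lemma symmSum_bordered_isUnit (hF : ringChar F ≠ 2) {ψ : AddChar F ℂ} (hψ : ψ.IsPrimitive)
    {g : ℕ → ℂ} (hg : ∀ r, Odd r → g r = g (r + 1)) {m : ℕ} {C : Matrix (Fin m) (Fin m) F}
    (hC : C.IsSymm) (hu : IsUnit C) {a : F} (ha : a ≠ 0) :
    (Fintype.card F - 1 : ℂ) * symmSum ψ g (bordered C 0 a) =
      Fintype.card F * symmSum ψ g C - symmSum ψ (pushWeight (Fintype.card F) m g) C := by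
  have h := sum_symmSum_bordered hF hψ g C
  have h1 (v : Fin m → F) : ∑ b, symmSum ψ g (bordered C v b) =
      symmSum ψ (pushWeight (Fintype.card F) m g) C +
        (Fintype.card F - 1 : ℂ) * symmSum ψ g (bordered C 0 a) := by
    obtain ⟨P, hP, hP'⟩ := exists_congruence_bordered hC hu v
    rw [Fintype.sum_equiv (Equiv.subRight (v ⬝ᵥ C⁻¹ *ᵥ v)) _
        (fun b => symmSum ψ g (bordered C 0 b)) fun b => by
          rw [← symmSum_congruence ψ g (bordered C v b) hP, hP', Equiv.subRight_apply],
      ← Finset.add_sum_erase _ _ (Finset.mem_univ (0 : F)), symmSum_bordered_zero, Fintype.card_fin]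
    congr 1
    rw [Finset.sum_congr rfl (g := fun _ => symmSum ψ g (bordered C 0 a)) fun b hb => by
      rw [symmSum_bordered_ne_zero hF hψ hg C (Finset.ne_of_mem_erase hb),
        symmSum_bordered_ne_zero hF hψ hg C ha], Finset.sum_const, nsmul_eq_mul,
      Finset.card_erase_of_mem (Finset.mem_univ _), Finset.card_univ,
      Nat.cast_pred Fintype.card_pos]
  simp_rw [h1] at h
  rw [Finset.sum_const, nsmul_eq_mul, Finset.card_univ, Fintype.card_fun, Fintype.card_fin,
    Nat.cast_pow, pow_succ, mul_assoc] at h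
  linear_combination mul_left_cancel₀ (pow_ne_zero m (cast_card_ne_zero (F := F))) h

/-- Up to congruence, a symmetric matrix is a bordered one; the larger block may be taken
invertible when the corner is nonzero. -/
lemma exists_symmSum_eq_bordered (hF : ringChar F ≠ 2) {m : ℕ}
    {C : Matrix (Fin (m + 1)) (Fin (m + 1)) F} (hC : C.IsSymm) :
    ∃ (D : Matrix (Fin m) (Fin m) F) (a : F), D.IsSymm ∧ (a ≠ 0 → IsUnit D) ∧
      C.rank = (bordered D 0 a).rank ∧
      ∀ (ψ : AddChar F ℂ) g, symmSum ψ g C = symmSum ψ g (bordered D 0 a) := by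
  obtain ⟨P, w, hP, hw⟩ := hC.exists_isUnit_diagonal (Ring.two_ne_zero hF)
  obtain ⟨i₀, hi⟩ : ∃ i₀, w i₀ ≠ 0 → ∀ i, w i ≠ 0 := by
    by_cases h : ∃ i, w i = 0
    · exact ⟨h.choose, fun h' => absurd h.choose_spec h'⟩
    · exact ⟨0, fun _ i hi => h ⟨i, hi⟩⟩
  let e : Fin m ⊕ Unit ≃ Fin (m + 1) :=
    (Equiv.optionEquivSumPUnit (Fin m)).symm.trans (finSuccEquiv' i₀).symm
  have hb : bordered (diagonal fun i => w (e (Sum.inl i))) 0 (w i₀) =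
      (Pᵀ * C * P).submatrix e e := by
    rw [hw, submatrix_diagonal_equiv]
    ext (i | i) (j | j) <;> simp [bordered, diagonal_apply, e]
  refine ⟨diagonal fun i => w (e (Sum.inl i)), w i₀, isSymm_diagonal _, fun h => ?_, ?_,
    fun ψ g => ?_⟩
  · rw [isUnit_diagonal, Pi.isUnit_iff]
    exact fun i => (hi h _).isUnit
  · rw [hb, rank_submatrix, rank_mul_eq_left_of_isUnit_det _ _ ((isUnit_iff_isUnit_det P).mp hP),
      rank_mul_eq_right_of_isUnit_det _ _ ((isUnit_iff_isUnit_det Pᵀ).mp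
        ((isUnit_transpose P).mpr hP))]
  · rw [hb, symmSum_submatrix, symmSum_congruence ψ g C hP]

end Recursion

section Weights

/-- The weight of a form of rank `r` in the linear programming argument. -/
def gaussWeight (q n j r : ℕ) : ℂ := gaussBinom (q ^ 2) (n - (r + 1) / 2) j

lemma gaussWeight_of_odd (q n j : ℕ) {r : ℕ} (hr : Odd r) :
    gaussWeight q n j r = gaussWeight q n j (r + 1) := by
  rw [gaussWeight, gaussWeight, show (r + 1) / 2 = (r + 1 + 1) / 2 by grind]

lemma pushWeight_gaussWeight (q m n j r : ℕ) :
    pushWeight q m (gaussWeight q n j) r =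
      ((q ^ 2) ^ ((r + 1) / 2) * gaussBinom (q ^ 2) (n - (r + 1) / 2) j : ℂ) +
        (q ^ (m + 1) - (q ^ 2) ^ ((r + 1) / 2)) *
          gaussBinom (q ^ 2) (n - ((r + 1) / 2 + 1)) j := by
  simp only [pushWeight, gaussWeight]
  rcases Nat.even_or_odd' r with ⟨s, rfl | rfl⟩
  · rw [show (2 * s + 1) / 2 = s by lia, show (2 * s + 1 + 1) / 2 = s + 1 by lia,
      show (2 * s + 2 + 1) / 2 = s + 1 by lia]
    ring
  · rw [show (2 * s + 1 + 1 + 1) / 2 = s + 1 by lia, show (2 * s + 1 + 1) / 2 = s + 1 by lia,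
      show (2 * s + 1 + 2 + 1) / 2 = s + 1 + 1 by lia]
    ring

lemma pushWeight_gaussWeight_odd (q : ℕ) {n i j r : ℕ} (hij : i + j = n + 1)
    (hr : r ≤ 2 * n + 1) : pushWeight q (2 * n + 1) (gaussWeight q (n + 1) j) r =
      (q : ℂ) ^ (2 * i) * gaussWeight q (n + 1) j r := by
  rw [pushWeight_gaussWeight, gaussWeight]
  obtain ⟨k, hk⟩ : ∃ k, (r + 1) / 2 = k := ⟨_, rfl⟩
  rw [hk]
  obtain ⟨d, hd⟩ := Nat.exists_eq_add_of_le (show k ≤ n + 1 by lia)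
  rw [show n + 1 - k = d by lia, show n + 1 - (k + 1) = d - 1 by lia]
  rcases d with _ | d
  · rw [show 2 * n + 1 + 1 = 2 * k by lia, pow_mul, sub_self, zero_mul, add_zero,
      gaussBinom.zero_left, pow_mul]
    split_ifs with h
    · rw [show k = i by lia]
    · simp
  · rw [Nat.add_sub_cancel]
    rcases j with _ | j
    · rw [show i = n + 1 by lia, show 2 * n + 1 + 1 = 2 * (n + 1) by ring]
      simp
    · have h1 := gaussBinom.pow_mul_succ_succ (q ^ 2) (n := d) (k := j) (a := k) (d := i) (by lia)
      have h2 := congrArg (Nat.cast (R := ℂ)) h1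
      have h3 := congrArg (Nat.cast (R := ℂ)) (gaussBinom.succ_succ (q ^ 2) d j)
      push_cast at h2 h3
      rw [show 2 * n + 1 + 1 = 2 * i + 2 * (j + 1) by lia]
      linear_combination h2 - q ^ (2 * i) * h3

lemma pushWeight_gaussWeight_even_zero (q n r : ℕ) :
    pushWeight q (2 * n) (gaussWeight q (n + 1) 0) r =
      (q : ℂ) ^ (2 * n + 1) * gaussWeight q n 0 r := by
  rw [pushWeight_gaussWeight, gaussWeight]
  simp

lemma pushWeight_gaussWeight_even_succ (q : ℕ) {n i j r : ℕ} (hij : i + j = n)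
    (hr : r ≤ 2 * n) : pushWeight q (2 * n) (gaussWeight q (n + 1) (j + 1)) r =
      (q : ℂ) ^ (2 * i) * gaussWeight q n j r +
        (q : ℂ) ^ (2 * n + 1) * gaussWeight q n (j + 1) r := by
  rw [pushWeight_gaussWeight, gaussWeight, gaussWeight]
  obtain ⟨k, hk⟩ : ∃ k, (r + 1) / 2 = k := ⟨_, rfl⟩
  rw [hk]
  obtain ⟨d, rfl⟩ := Nat.exists_eq_add_of_le (show k ≤ n by lia)
  rw [show k + d + 1 - k = d + 1 by lia, show k + d + 1 - (k + 1) = d by lia,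
    show k + d - k = d by lia]
  have h1 := gaussBinom.pow_mul_succ_succ (q ^ 2) (n := d) (k := j) (a := k) (d := i) (by lia)
  have h2 := congrArg (Nat.cast (R := ℂ)) h1
  push_cast at h2
  linear_combination h2

lemma gaussWeight_succ_succ (q : ℕ) {n j r : ℕ} (hr : r ≤ 2 * n) :
    gaussWeight q (n + 1) (j + 1) r =
      gaussWeight q n j r + (q : ℂ) ^ (2 * (j + 1)) * gaussWeight q n (j + 1) r := by
  rw [gaussWeight, gaussWeight, gaussWeight,
    show n + 1 - (r + 1) / 2 = n - (r + 1) / 2 + 1 by lia, gaussBinom.succ_succ]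
  push_cast
  ring

end Weights

section Main

variable {F : Type*} [Field F] [Fintype F] [DecidableEq F]
variable {ι : Type*} [Fintype ι] [DecidableEq ι]

lemma symmSum_congr (ψ : AddChar F ℂ) {f g : ℕ → ℂ} (C : Matrix ι ι F)
    (h : ∀ r ≤ Fintype.card ι, f r = g r) : symmSum ψ f C = symmSum ψ g C :=
  Finset.sum_congr rfl fun x _ => by rw [h _ x.1.rank_le_card_width]

lemma symmSum_add (ψ : AddChar F ℂ) (f g : ℕ → ℂ) (C : Matrix ι ι F) :
    symmSum ψ (fun r => f r + g r) C = symmSum ψ f C + symmSum ψ g C := by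
  simp only [symmSum, add_mul, Finset.sum_add_distrib]

lemma symmSum_const_mul (ψ : AddChar F ℂ) (a : ℂ) (f : ℕ → ℂ) (C : Matrix ι ι F) :
    symmSum ψ (fun r => a * f r) C = a * symmSum ψ f C := by
  simp only [symmSum, mul_assoc, Finset.mul_sum]

omit [DecidableEq F] in
lemma cast_card_sub_one_ne_zero : (Fintype.card F - 1 : ℂ) ≠ 0 := by
  have := Fintype.one_lt_card (α := F)
  rw [sub_ne_zero]
  exact_mod_cast this.ne'

lemma gaussWeight_eq_zero (q : ℕ) {n i r : ℕ} (hr : n < (r + 1) / 2 + i) (hi : i ≠ 0) :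
    gaussWeight q n i r = 0 := by
  rw [gaussWeight, gaussBinom.eq_zero_of_lt _ (by lia), Nat.cast_zero]

lemma gaussWeight_zero (q n r : ℕ) : gaussWeight q n 0 r = 1 := by
  simp [gaussWeight]

omit [Fintype F] [DecidableEq F] in
lemma Matrix.rank_eq_of_isUnit {m : ℕ} {D : Matrix (Fin m) (Fin m) F} (hD : IsUnit D) :
    D.rank = m := by
  rw [rank_of_isUnit D hD, Fintype.card_fin]

/-- The Fourier transform on symmetric matrices exchanges the weights `gaussWeight`. -/
theorem symmSum_gaussWeight (hF : ringChar F ≠ 2) {ψ : AddChar F ℂ} (hψ : ψ.IsPrimitive) {m : ℕ} :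
    ∀ {i j : ℕ}, i + j = (m + 1) / 2 → ∀ {C : Matrix (Fin m) (Fin m) F}, C.IsSymm →
      symmSum ψ (gaussWeight (Fintype.card F) ((m + 1) / 2) j) C =
        (Fintype.card F : ℂ) ^ ((2 * (m / 2) + 1) * i) *
          gaussWeight (Fintype.card F) ((m + 1) / 2) i C.rank := by
  induction m with
  | zero =>
    intro i j hij C hC
    obtain ⟨rfl, rfl⟩ : i = 0 ∧ j = 0 := by lia
    have : Unique {x : Matrix (Fin 0) (Fin 0) F // x.IsSymm} :=
      ⟨⟨⟨0, isSymm_zero⟩⟩, fun x => Subtype.ext (Subsingleton.elim _ _)⟩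
    simp [symmSum, gaussWeight_zero, Matrix.trace]
  | succ m ih =>
    intro i j hij C hC
    set q := Fintype.card F with hq
    obtain ⟨D, a, hD, ha, hr, hs⟩ := exists_symmSum_eq_bordered hF hC
    rw [hs, hr, rank_bordered_zero D hD]
    have hrD : D.rank ≤ m := by simpa using D.rank_le_card_width
    have hodd (n j : ℕ) : ∀ r, Odd r → gaussWeight q n j r = gaussWeight q n j (r + 1) :=
      fun r => gaussWeight_of_odd q n j
    have hpush {n : ℕ} {f : ℕ → ℂ} (h : ∀ r ≤ m, pushWeight q m (gaussWeight q n j) r = f r) :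
        symmSum ψ (pushWeight q m (gaussWeight q n j)) D = symmSum ψ f D :=
      symmSum_congr ψ D fun r hr => h r (by rwa [Fintype.card_fin] at hr)
    rcases Nat.even_or_odd' m with ⟨n, rfl | rfl⟩
    · rw [show (2 * n + 1 + 1) / 2 = n + 1 by lia, show (2 * n + 1) / 2 = n by lia] at *
      rw [show 2 * n / 2 = n by lia] at ih
      rcases j with _ | j
      · obtain rfl : i = n + 1 := by lia
        have hT := hpush fun r _ => pushWeight_gaussWeight_even_zero q n r
        rw [symmSum_const_mul, ih (add_zero n) hD] at hT
        rcases eq_or_ne a 0 with rfl | ha0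
        · rw [symmSum_bordered_zero, Fintype.card_fin, hT, if_pos rfl, add_zero,
            gaussWeight_succ_succ q hrD, gaussWeight_eq_zero q (i := n + 1) (by lia) (by lia)]
          ring
        · have h := symmSum_bordered_isUnit hF hψ (hodd (n + 1) 0) hD (ha ha0) ha0
          refine mul_left_cancel₀ (cast_card_sub_one_ne_zero (F := F)) (h.trans ?_)
          have h0 : symmSum ψ (gaussWeight q (n + 1) 0) D = symmSum ψ (gaussWeight q n 0) D := by
            simp only [symmSum, gaussWeight_zero]
          rw [hT, h0, ih (add_zero n) hD, rank_eq_of_isUnit (ha ha0), if_neg ha0,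
            gaussWeight_eq_zero q (i := n + 1) (by lia) (by lia)]
          rcases n with _ | n
          · simp [hq]
          · rw [gaussWeight_eq_zero q (by lia) (by lia)]
            ring
      · have hT := hpush fun r hr => pushWeight_gaussWeight_even_succ q (i := i) (by lia) hr
        rw [symmSum_add, symmSum_const_mul, symmSum_const_mul, ih (i := i) (by lia) hD] at hT
        have h1 : symmSum ψ (gaussWeight q (n + 1) (j + 1)) D = _ :=
          symmSum_congr ψ D fun r hr =>
            gaussWeight_succ_succ q (j := j) (by rwa [Fintype.card_fin] at hr)
        rw [symmSum_add, symmSum_const_mul, ih (i := i) (by lia) hD] at h1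
        have h := fun ha0 : a ≠ 0 =>
          symmSum_bordered_isUnit hF hψ (hodd (n + 1) (j + 1)) hD (ha ha0) ha0
        rcases i with _ | i
        · have h0 : symmSum ψ (gaussWeight q n (j + 1)) D = 0 :=
            Finset.sum_eq_zero fun x _ => by
              rw [gaussWeight_eq_zero q (by lia) (by lia), zero_mul]
          rw [h0] at hT h1
          simp only [mul_zero, pow_zero, gaussWeight_zero, mul_one, add_zero] at hT h1 ⊢
          rcases eq_or_ne a 0 with rfl | ha0
          · rw [symmSum_bordered_zero, Fintype.card_fin, hT]
          · refine mul_left_cancel₀ (cast_card_sub_one_ne_zero (F := F)) ((h ha0).trans ?_)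
            rw [hT, h1, mul_one, mul_one]
        · rw [ih (i := i) (by lia) hD] at hT h1
          rcases eq_or_ne a 0 with rfl | ha0
          · rw [symmSum_bordered_zero, Fintype.card_fin, hT, if_pos rfl, add_zero,
              gaussWeight_succ_succ q hrD]
            ring
          · refine mul_left_cancel₀ (cast_card_sub_one_ne_zero (F := F)) ((h ha0).trans ?_)
            rw [hT, h1, rank_eq_of_isUnit (ha ha0), if_neg ha0,
              gaussWeight_eq_zero q (i := i + 1) (by lia) (by lia),
              gaussWeight_eq_zero q (i := i + 1) (by lia) (by lia)]
            rcases i with _ | i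
            · rw [show n = j + 1 by lia, gaussWeight_zero, hq]
              ring
            · rw [gaussWeight_eq_zero q (by lia) (by lia)]
              ring
    · rw [show (2 * n + 1 + 1 + 1) / 2 = n + 1 by lia] at *
      rw [show (2 * n + 1 + 1) / 2 = n + 1 by lia] at *
      rw [show (2 * n + 1) / 2 = n by lia] at ih
      have hT := hpush fun r hr => pushWeight_gaussWeight_odd q hij hr
      rw [symmSum_const_mul] at hT
      rcases eq_or_ne a 0 with rfl | ha0
      · rw [symmSum_bordered_zero, Fintype.card_fin, hT, ih hij hD, if_pos rfl, add_zero]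
        ring
      · have h := symmSum_bordered_isUnit hF hψ (hodd (n + 1) j) hD (ha ha0) ha0
        refine mul_left_cancel₀ (cast_card_sub_one_ne_zero (F := F)) (h.trans ?_)
        rw [hT, ih hij hD, rank_eq_of_isUnit (ha ha0), if_neg ha0]
        rcases i with _ | i
        · simp [gaussWeight_zero]
        · rw [gaussWeight_eq_zero _ (by lia) (by lia), gaussWeight_eq_zero _ (by lia) (by lia)]
          ring

end Main

section Codes

variable {F : Type*} [Field F] [Fintype F] [DecidableEq F]

/-- The linear programming bound for additive codes of symmetric matrices. -/
theorem natCard_le_of_le_rank (hF : ringChar F ≠ 2) {m d : ℕ}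
    (Y : AddSubgroup (Matrix (Fin m) (Fin m) F)) (hsymm : ∀ y ∈ Y, y.IsSymm) (hd : 1 ≤ d)
    (hdm : 2 * d - 1 ≤ m) (hY : ∀ y ∈ Y, y ≠ 0 → 2 * d - 1 ≤ y.rank) :
    Nat.card Y ≤ Fintype.card F ^ ((2 * (m / 2) + 1) * ((m + 1) / 2 - d + 1)) := by
  classical
  set q := Fintype.card F
  obtain ⟨j, rfl⟩ := Nat.exists_eq_add_of_le' hd
  obtain ⟨i, hi⟩ : ∃ i, (m + 1) / 2 - (j + 1) + 1 = i := ⟨_, rfl⟩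
  have hij : i + j = (m + 1) / 2 := by lia
  have : Fintype Y := Fintype.ofFinite Y
  have hψ := AddChar.FiniteField.primitiveChar_to_Complex_isPrimitive F
  set ψ := AddChar.FiniteField.primitiveChar_to_Complex F
  let χ (x : Matrix (Fin m) (Fin m) F) : AddChar Y ℂ := ψ.compAddMonoidHom
    ((traceAddMonoidHom (Fin m) F).comp ((AddMonoidHom.mulRight x).comp Y.subtype))
  have hR : ∑ y : Y, symmSum ψ (gaussWeight q ((m + 1) / 2) j) y.1 =
      (q : ℂ) ^ ((2 * (m / 2) + 1) * i) * gaussBinom (q ^ 2) (i + j) i := by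
    rw [Finset.sum_congr rfl fun y _ => symmSum_gaussWeight hF hψ hij (hsymm y.1 y.2),
      ← Finset.mul_sum, Finset.sum_eq_single 0]
    · simp [gaussWeight, hij, q]
    · intro y _ hy
      have := hY y.1 y.2 fun h => hy (Subtype.ext h)
      exact gaussWeight_eq_zero q (by lia) (by lia)
    · simp
  have hL : ∑ y : Y, symmSum ψ (gaussWeight q ((m + 1) / 2) j) y.1 =
      ∑ x : {x : Matrix (Fin m) (Fin m) F // x.IsSymm},
        gaussWeight q ((m + 1) / 2) j x.1.rank * if χ x.1 = 0 then (Fintype.card Y : ℂ) else 0 := by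
    simp_rw [symmSum]
    rw [Finset.sum_comm]
    refine Finset.sum_congr rfl fun x _ => ?_
    rw [← Finset.mul_sum, ← AddChar.sum_eq_ite (χ x.1)]
    rfl
  have hN : ∑ x : {x : Matrix (Fin m) (Fin m) F // x.IsSymm},
      gaussBinom (q ^ 2) (i + j - (x.1.rank + 1) / 2) j *
        (if χ x.1 = 0 then Fintype.card Y else 0) =
      q ^ ((2 * (m / 2) + 1) * i) * gaussBinom (q ^ 2) (i + j) i := by
    have := hL.symm.trans hR
    simp only [gaussWeight, ← hij] at this
    exact_mod_cast this
  have h0 := (Finset.single_le_sum (fun _ _ => Nat.zero_le _)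
    (Finset.mem_univ ⟨0, isSymm_zero⟩)).trans_eq hN
  have hχ : χ 0 = 0 := by
    ext y
    simp [χ]
  rw [if_pos hχ, rank_zero, Nat.zero_add, gaussBinom.symm, mul_comm] at h0
  rw [hi, Nat.card_eq_fintype_card]
  exact Nat.le_of_mul_le_mul_right h0 (gaussBinom.pos _ i j)

omit [Fintype F] [DecidableEq F] in
lemma LinearMap.rank_toMatrix₂ {V : Type*} [AddCommGroup V] [Module F V] {ι : Type*} [Fintype ι]
    [DecidableEq ι] (b : Module.Basis ι F V) (B : V →ₗ[F] V →ₗ[F] F) :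
    (LinearMap.toMatrix₂ b b B).rank = Module.finrank F V - Module.finrank F (LinearMap.ker B) := by
  have : Module.Finite F V := .of_basis b
  have h : LinearMap.toMatrix₂ b b B = (LinearMap.toMatrix b b.dualBasis B)ᵀ := by
    ext i j
    rw [LinearMap.toMatrix₂_apply, transpose_apply, LinearMap.toMatrix_apply,
      Module.Basis.dualBasis_repr]
  rw [h, rank_transpose, rank_eq_finrank_range_toLin _ b.dualBasis b, Matrix.toLin_toMatrix]
  exact Nat.eq_sub_of_add_eq (LinearMap.finrank_range_add_finrank_ker B)

end Codes

/-- Let `q` be an odd prime power, `V` an `m`-dimensional `F_q`-vector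
space, and `Y` an additive subgroup of the group of symmetric bilinear forms on `V` such
that every nonzero element of `Y` has rank at least `2δ−1` (a `(2δ−1)`-code), the rank of
a form being the codimension of its radical. Then `|Y| ≤ q^{m((m+1)/2−δ+1)}` if `m` is
odd, and `|Y| ≤ q^{(m+1)(m/2−δ+1)}` if `m` is even. -/
theorem additive_odd_distance_code_bound (q m δ : ℕ) (F : Type*) [Field F] [Fintype F]
    (hq : Fintype.card F = q) (hodd : Odd q)
    (V : Type*) [AddCommGroup V] [Module F V]
    (hV : Module.finrank F V = m)
    (Y : AddSubgroup (V →ₗ[F] V →ₗ[F] F))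
    (hsym : ∀ B ∈ Y, ∀ x y : V, B x y = B y x)
    (hδ : 1 ≤ δ) (hδm : 2 * δ - 1 ≤ m)
    (hcode : ∀ B ∈ Y, B ≠ 0 → 2 * δ - 1 ≤ m - Module.finrank F (LinearMap.ker B)) :
    (Odd m → Nat.card Y ≤ q ^ (m * ((m + 1) / 2 - δ + 1))) ∧
      (Even m → Nat.card Y ≤ q ^ ((m + 1) * (m / 2 - δ + 1))) := by
  classical
  have hF : ringChar F ≠ 2 := fun h =>
    Nat.not_even_iff_odd.mpr (hq ▸ hodd)
      (Nat.even_iff.mpr (FiniteField.even_card_iff_char_two.mp h))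
  have : Module.Finite F V := Module.finite_of_finrank_pos (by lia)
  let b := Module.finBasisOfFinrankEq F V hV
  let e : (V →ₗ[F] V →ₗ[F] F) ≃ₗ[F] Matrix (Fin m) (Fin m) F := LinearMap.toMatrix₂ b b
  have h := natCard_le_of_le_rank hF (Y.map e.toLinearMap.toAddMonoidHom) (d := δ) ?_ hδ hδm ?_
  · rw [AddSubgroup.card_map_of_injective e.injective, hq] at h
    constructor <;> rintro ⟨n, rfl⟩
    · rwa [show 2 * ((2 * n + 1) / 2) + 1 = 2 * n + 1 by lia] at h
    · rwa [show 2 * ((n + n) / 2) + 1 = n + n + 1 by lia,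
        show (n + n + 1) / 2 = (n + n) / 2 by lia] at h
  · rintro _ ⟨B, hB, rfl⟩
    refine IsSymm.ext fun i j => ?_
    change LinearMap.toMatrix₂ b b B j i = LinearMap.toMatrix₂ b b B i j
    rw [LinearMap.toMatrix₂_apply, LinearMap.toMatrix₂_apply, hsym B hB]
  · rintro _ ⟨B, hB, rfl⟩ h0
    change _ ≤ (LinearMap.toMatrix₂ b b B).rank
    rw [LinearMap.rank_toMatrix₂, hV]
    exact hcode B hB fun h => h0 (by rw [h, map_zero])
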